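/- Let l ≥ 2 be an integer, let λ_l be the unique solution x > 1 of x^{l-1} = x^{l-2} + ... + x + 1, let λ > λ_l, and let N = {n_k} be a λ-lacunary sequence of positive integers. If complex coefficients {c_m : m ∈ N(l)} satisfy ∑_{m ∈ N(l)} |c_m|² < ∞, then for every increasing sequence Γ_1 ⊂ Γ_2 ⊂ ... of finite subsets of N(l), the sums ∑_{m ∈ Γ_n} c_m e^{2πimx} converge for almost every x ∈ (0,1) as n → ∞. In particular, the system {e^{2πimx} : m ∈ N(l)} is an unconditional convergence system: any arrangement of the series ∑_{m} c_m e^{2πimx} converges almost everywhere. -/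

import Mathlib

open MeasureTheory Filter Finset Topology

noncomputable section

/-- A sequence of positive integers is `lam`-lacunary if `n (k+1) / n k > lam` for all `k`. -/
def IsLacunary (lam : ℝ) (n : ℕ → ℕ) : Prop :=
  (∀ k, 0 < n k) ∧ ∀ k, lam * (n k : ℝ) < (n (k + 1) : ℝ)

/-- The exponential `e^{2πimx}`. -/
def expi (m : ℤ) (x : ℝ) : ℂ := Complex.exp (2 * Real.pi * Complex.I * m * x)

/-- `N(l)`: integers of the form `ε₁ n_{k₁} + ⋯ + ε_l n_{k_l}` with `ε_j = ±1` and
`k₁ > k₂ > ⋯ > k_l`. -/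
def SignedSums (n : ℕ → ℕ) (l : ℕ) : Set ℤ :=
  {m | ∃ (k : Fin l → ℕ) (ε : Fin l → ℤ),
    StrictAnti k ∧ (∀ j, ε j = 1 ∨ ε j = -1) ∧ m = ∑ j, ε j * (n (k j) : ℤ)}


/-- The Lebesgue measure on `(0,1)`. -/
abbrev muI : Measure ℝ := volume.restrict (Set.Ioo (0:ℝ) 1)

/-- Trigonometric polynomial. -/
def tp (c : ℤ → ℂ) (Γ : Finset ℤ) (x : ℝ) : ℂ := ∑ m ∈ Γ, c m * expi m x

lemma expi_continuous (m : ℤ) : Continuous (expi m) := by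
  unfold expi; fun_prop

lemma tp_continuous (c : ℤ → ℂ) (Γ : Finset ℤ) : Continuous (tp c Γ) := by
  unfold tp
  exact continuous_finsetSum _ fun m _ => continuous_const.mul (expi_continuous m)

lemma expi_add (a b : ℤ) (x : ℝ) : expi (a + b) x = expi a x * expi b x := by
  unfold expi; rw [← Complex.exp_add]; push_cast; ring_nf

lemma expi_conj (a : ℤ) (x : ℝ) : (starRingEnd ℂ) (expi a x) = expi (-a) x := by
  unfold expi; rw [← Complex.exp_conj]; simp [Complex.conj_ofNat]

lemma expi_norm (a : ℤ) (x : ℝ) : ‖expi a x‖ = 1 := by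
  unfold expi
  have : (2 * Real.pi * Complex.I * a * x : ℂ) = ((2 * Real.pi * a * x : ℝ) : ℂ) * Complex.I := by
    push_cast; ring
  rw [this, Complex.norm_exp_ofReal_mul_I]

lemma integ_of_cont {E : Type*} [NormedAddCommGroup E] {f : ℝ → E} (hf : Continuous f) :
    Integrable f muI :=
  (hf.integrableOn_Icc (a := 0) (b := 1)).mono_set Set.Ioo_subset_Icc_self

lemma expi_integral (m : ℤ) (hm : m ≠ 0) : ∫ x, expi m x ∂muI = 0 := by
  rw [← integral_Ioc_eq_integral_Ioo, ← intervalIntegral.integral_of_le zero_le_one]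
  unfold expi
  have h : (2 * Real.pi * Complex.I * m : ℂ) ≠ 0 := by
    simp [Real.pi_ne_zero, hm]
  rw [integral_exp_mul_complex h]
  have : Complex.exp (2 * Real.pi * Complex.I * m * (1:ℝ)) = 1 := by
    rw [Complex.exp_eq_one_iff]; exact ⟨m, by push_cast; ring⟩
  rw [this]; simp

lemma cross_zero (c : ℤ → ℂ) (A B : Finset ℤ)
    (h : ∀ a ∈ A, ∀ b ∈ B, 3 * |a| < |b|) :
    ∫ x, ‖tp c A x‖ ^ 2 * ((starRingEnd ℂ) (tp c A x) * tp c B x).re ∂muI = 0 := by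
  have hcont : Continuous fun x => (tp c A x * (starRingEnd ℂ) (tp c A x)) *
      ((starRingEnd ℂ) (tp c A x) * tp c B x) := by
    have h1 := tp_continuous c A
    have h2 := tp_continuous c B
    have h3 := Complex.continuous_conj.comp h1
    exact (h1.mul h3).mul (h3.mul h2)
  have e1 : ∀ x, ‖tp c A x‖ ^ 2 * ((starRingEnd ℂ) (tp c A x) * tp c B x).re
      = RCLike.re ((tp c A x * (starRingEnd ℂ) (tp c A x)) *
      ((starRingEnd ℂ) (tp c A x) * tp c B x)) := by
    intro x
    rw [Complex.mul_conj, Complex.normSq_eq_norm_sq]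
    exact (Complex.re_ofReal_mul _ _).symm
  simp_rw [e1]
  rw [integral_re (integ_of_cont hcont)]
  have e2 : ∀ x, (tp c A x * (starRingEnd ℂ) (tp c A x)) *
      ((starRingEnd ℂ) (tp c A x) * tp c B x) =
      ∑ p ∈ A ×ˢ A, ∑ q ∈ A ×ˢ B, (c p.1 * (starRingEnd ℂ) (c p.2) *
        (starRingEnd ℂ) (c q.1) * c q.2) * expi (p.1 - p.2 - q.1 + q.2) x := by
    intro x
    unfold tp
    simp only [map_sum, map_mul]
    rw [Finset.sum_mul_sum, Finset.sum_mul_sum, ← Finset.sum_product', ← Finset.sum_product',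
      Finset.sum_mul_sum]
    refine Finset.sum_congr rfl fun p _ => Finset.sum_congr rfl fun q _ => ?_
    rw [expi_conj, expi_conj, sub_eq_add_neg, sub_eq_add_neg, expi_add, expi_add, expi_add]
    ring
  simp_rw [e2]
  rw [integral_finsetSum]
  · rw [Finset.sum_eq_zero]; · simp
    intro p hp
    rw [integral_finsetSum]
    · refine Finset.sum_eq_zero fun q hq => ?_
      rw [integral_const_mul, expi_integral, mul_zero]
      rw [Finset.mem_product] at hp hq
      have h1 := h _ hp.1 _ hq.2
      have h2 := h _ hp.2 _ hq.2
      have h3 := h _ hq.1 _ hq.2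
      intro h0
      rw [abs_eq_max_neg, abs_eq_max_neg] at h1 h2 h3
      omega
    · intro q _
      exact integ_of_cont (continuous_const.mul (expi_continuous _))
  · intro p _
    refine integrable_finsetSum _ fun q _ => ?_
    exact integ_of_cont (continuous_const.mul (expi_continuous _))

lemma pt_ineq (S G : ℂ) : ‖S + G‖ ^ 4 ≤ ‖S‖ ^ 4 + 4 * (‖S‖ ^ 2 * ((starRingEnd ℂ) S * G).re)
    + 8 * (‖S‖ ^ 2 * ‖G‖ ^ 2) + 3 * ‖G‖ ^ 4 := by
  have h1 : ‖S + G‖ ^ 2 = ‖S‖ ^ 2 + 2 * ((starRingEnd ℂ) S * G).re + ‖G‖ ^ 2 := by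
    rw [← Complex.normSq_eq_norm_sq, ← Complex.normSq_eq_norm_sq, ← Complex.normSq_eq_norm_sq]
    simp [Complex.normSq_apply]; ring
  have h2 : |((starRingEnd ℂ) S * G).re| ≤ ‖S‖ * ‖G‖ := by
    refine (Complex.abs_re_le_norm _).trans ?_
    simp
  set t := ((starRingEnd ℂ) S * G).re
  have hS := norm_nonneg S
  have hG := norm_nonneg G
  generalize ‖S‖ = s at *
  generalize ‖G‖ = g at *
  have h3 : t ^ 2 ≤ (s * g) ^ 2 := sq_le_sq' (by linarith [neg_abs_le t]) (by linarith [le_abs_self t])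
  have h4 : t * g ^ 2 ≤ (s * g) * g ^ 2 :=
    mul_le_mul_of_nonneg_right (by linarith [le_abs_self t]) (sq_nonneg _)
  have h5 : ‖S + G‖ ^ 4 = (‖S + G‖ ^ 2) ^ 2 := by ring
  rw [h5, h1]
  nlinarith [sq_nonneg (s * g - g * g)]

lemma cs_ineq {f g : ℝ → ℝ} (hf : Continuous f) (hg : Continuous g) {a b : ℝ} (ha : 0 ≤ a)
    (hb : 0 ≤ b) (h1 : ∫ x, f x ^ 4 ∂muI ≤ a ^ 2) (h2 : ∫ x, g x ^ 4 ∂muI ≤ b ^ 2) :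
    ∫ x, f x ^ 2 * g x ^ 2 ∂muI ≤ a * b := by
  have key : ∀ t : ℝ, 0 < t → ∫ x, f x ^ 2 * g x ^ 2 ∂muI ≤ (t * a ^ 2 + t⁻¹ * b ^ 2) / 2 := by
    intro t ht
    calc ∫ x, f x ^ 2 * g x ^ 2 ∂muI
        ≤ ∫ x, (t / 2 * f x ^ 4 + t⁻¹ / 2 * g x ^ 4) ∂muI := by
          refine integral_mono (integ_of_cont (by fun_prop)) (integ_of_cont (by fun_prop)) ?_
          intro x
          have : t * t⁻¹ = 1 := mul_inv_cancel₀ ht.ne'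
          have h3 : 0 ≤ t⁻¹ * (t * f x ^ 2 - g x ^ 2) ^ 2 := by positivity
          have h4 : t⁻¹ * (t * f x ^ 2 - g x ^ 2) ^ 2 =
            t * f x ^ 4 - 2 * (f x ^ 2 * g x ^ 2) + t⁻¹ * g x ^ 4 := by
            field_simp; ring
          show f x ^ 2 * g x ^ 2 ≤ t / 2 * f x ^ 4 + t⁻¹ / 2 * g x ^ 4
          linarith
      _ = t / 2 * ∫ x, f x ^ 4 ∂muI + t⁻¹ / 2 * ∫ x, g x ^ 4 ∂muI := by
          rw [integral_add (integ_of_cont (by fun_prop)) (integ_of_cont (by fun_prop)),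
            integral_const_mul, integral_const_mul]
      _ ≤ t / 2 * a ^ 2 + t⁻¹ / 2 * b ^ 2 := by gcongr
      _ = _ := by ring
  refine le_of_forall_pos_le_add fun ε hε => ?_
  -- choose t = (b+δ)/(a+δ)
  obtain ⟨δ, hδ, hδ2⟩ : ∃ δ : ℝ, 0 < δ ∧ (a + δ) * (b + δ) ≤ a * b + ε := by
    refine ⟨min 1 (ε / (a + b + 1)), by positivity, ?_⟩
    have h3 : min 1 (ε / (a + b + 1)) ≤ 1 := min_le_left _ _
    have h4 : min 1 (ε / (a + b + 1)) ≤ ε / (a + b + 1) := min_le_right _ _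
    have h5 : 0 < min 1 (ε / (a + b + 1)) := by positivity
    rw [le_div_iff₀ (by positivity)] at h4
    nlinarith
  have := key ((b + δ) / (a + δ)) (by positivity)
  refine this.trans (le_trans ?_ hδ2)
  have e1 : (b + δ) / (a + δ) * a ^ 2 ≤ (b + δ) / (a + δ) * (a + δ) ^ 2 := by gcongr; linarith
  have e2 : ((b + δ) / (a + δ))⁻¹ * b ^ 2 ≤ ((b + δ) / (a + δ))⁻¹ * (b + δ) ^ 2 := by
    gcongr; linarith
  have e3 : (b + δ) / (a + δ) * (a + δ) ^ 2 = (a + δ) * (b + δ) := by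
    field_simp
  have e4 : ((b + δ) / (a + δ))⁻¹ * (b + δ) ^ 2 = (a + δ) * (b + δ) := by
    field_simp
  linarith

lemma add_block (c : ℤ → ℂ) (A B : Finset ℤ) (h : ∀ a ∈ A, ∀ b ∈ B, 3 * |a| < |b|)
    {s g : ℝ} (hs : 0 ≤ s) (hg : 0 ≤ g)
    (hA : ∫ x, ‖tp c A x‖ ^ 4 ∂muI ≤ s ^ 2) (hB : ∫ x, ‖tp c B x‖ ^ 4 ∂muI ≤ g ^ 2) :
    ∫ x, ‖tp c A x + tp c B x‖ ^ 4 ∂muI ≤ (s + 4 * g) ^ 2 := by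
  have cA := tp_continuous c A
  have cB := tp_continuous c B
  have cC : Continuous fun x => ‖tp c A x‖ ^ 2 * ((starRingEnd ℂ) (tp c A x) * tp c B x).re :=
    (cA.norm.pow 2).mul (Complex.continuous_re.comp ((Complex.continuous_conj.comp cA).mul cB))
  have hcs := cs_ineq cA.norm cB.norm hs hg hA hB
  calc ∫ x, ‖tp c A x + tp c B x‖ ^ 4 ∂muI
      ≤ ∫ x, (‖tp c A x‖ ^ 4 + 4 * (‖tp c A x‖ ^ 2 * ((starRingEnd ℂ) (tp c A x) * tp c B x).re)
    + 8 * (‖tp c A x‖ ^ 2 * ‖tp c B x‖ ^ 2) + 3 * ‖tp c B x‖ ^ 4) ∂muI := by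
        refine integral_mono (integ_of_cont (by fun_prop)) (integ_of_cont (by fun_prop)) ?_
        intro x; exact pt_ineq _ _
    _ = ∫ x, ‖tp c A x‖ ^ 4 ∂muI + 4 * 0 + 8 * ∫ x, ‖tp c A x‖ ^ 2 * ‖tp c B x‖ ^ 2 ∂muI
        + 3 * ∫ x, ‖tp c B x‖ ^ 4 ∂muI := by
        rw [integral_add (integ_of_cont (by fun_prop)) (integ_of_cont (by fun_prop)),
          integral_add (integ_of_cont (by fun_prop)) (integ_of_cont (by fun_prop)),
          integral_add (integ_of_cont (by fun_prop)) (integ_of_cont (by fun_prop)),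
          integral_const_mul, integral_const_mul, integral_const_mul, cross_zero c A B h]
    _ ≤ (s + 4 * g) ^ 2 := by nlinarith

lemma blocks (c : ℤ → ℂ) (Γ : Finset ℤ) (κ : ℤ → ℕ) (K : ℝ) (hK : 0 ≤ K)
    (hsep : ∀ a ∈ Γ, ∀ b ∈ Γ, κ a < κ b → 3 * |a| < |b|)
    (hblock : ∀ k, ∫ x, ‖tp c (Γ.filter (fun m => κ m = k)) x‖ ^ 4 ∂muI
      ≤ (K * ∑ m ∈ Γ.filter (fun m => κ m = k), ‖c m‖ ^ 2) ^ 2) :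
    ∫ x, ‖tp c Γ x‖ ^ 4 ∂muI ≤ (4 * K * ∑ m ∈ Γ, ‖c m‖ ^ 2) ^ 2 := by
  have key : ∀ N : ℕ, ∫ x, ‖tp c (Γ.filter (fun m => κ m < N)) x‖ ^ 4 ∂muI
      ≤ (4 * K * ∑ m ∈ Γ.filter (fun m => κ m < N), ‖c m‖ ^ 2) ^ 2 := by
    intro N
    induction N with
    | zero => simp [tp]
    | succ N ih =>
      have hd : Disjoint (Γ.filter (fun m => κ m < N)) (Γ.filter (fun m => κ m = N)) := by
        rw [Finset.disjoint_filter]; intro m _ h1 h2; omega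
      have he : Γ.filter (fun m => κ m < N + 1) =
          (Γ.filter (fun m => κ m < N)) ∪ (Γ.filter (fun m => κ m = N)) := by
        ext m; simp only [Finset.mem_filter, Finset.mem_union]
        rw [Nat.lt_succ_iff_lt_or_eq]; tauto
      have e1 : ∀ x, tp c (Γ.filter (fun m => κ m < N + 1)) x =
          tp c (Γ.filter (fun m => κ m < N)) x + tp c (Γ.filter (fun m => κ m = N)) x := by
        intro x; unfold tp; rw [he, Finset.sum_union hd]
      simp_rw [e1]
      have := add_block c (Γ.filter (fun m => κ m < N)) (Γ.filter (fun m => κ m = N))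
        (by
          intro a ha b hb
          rw [Finset.mem_filter] at ha hb
          exact hsep a ha.1 b hb.1 (by omega)) (by positivity) (by positivity) ih (hblock N)
      refine this.trans (le_of_eq ?_)
      rw [he, Finset.sum_union hd]; ring
  have h2 := key (Γ.sup κ + 1)
  have h3 : Γ.filter (fun m => κ m < Γ.sup κ + 1) = Γ := by
    refine Finset.filter_true_of_mem fun m hm => ?_
    exact Nat.lt_succ_of_le (Finset.le_sup hm)
  rwa [h3] at h2

/-- Splitting into classes. -/
lemma classes {ι : Type} [Fintype ι] [DecidableEq ι] (c : ℤ → ℂ) (Γ : Finset ℤ) (τ : ℤ → ι) (K : ℝ) (hK : 0 ≤ K)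
    (h : ∀ j, ∫ x, ‖tp c (Γ.filter (fun m => τ m = j)) x‖ ^ 4 ∂muI
      ≤ (K * ∑ m ∈ Γ.filter (fun m => τ m = j), ‖c m‖ ^ 2) ^ 2) :
    ∫ x, ‖tp c Γ x‖ ^ 4 ∂muI ≤ ((Fintype.card ι : ℝ) ^ 2 * K * ∑ m ∈ Γ, ‖c m‖ ^ 2) ^ 2 := by
  have e1 : ∀ x, tp c Γ x = ∑ j, tp c (Γ.filter (fun m => τ m = j)) x := by
    intro x; unfold tp
    exact (Finset.sum_fiberwise _ _ _).symm
  have e2 : ∑ m ∈ Γ, ‖c m‖ ^ 2 = ∑ j, ∑ m ∈ Γ.filter (fun m => τ m = j), ‖c m‖ ^ 2 :=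
    (Finset.sum_fiberwise _ _ _).symm
  have hc : ∀ j, Continuous (fun x => ‖tp c (Γ.filter (fun m => τ m = j)) x‖ ^ 4) :=
    fun j => (tp_continuous _ _).norm.pow 4
  calc ∫ x, ‖tp c Γ x‖ ^ 4 ∂muI
      ≤ ∫ x, (Fintype.card ι : ℝ) ^ 3 * ∑ j, ‖tp c (Γ.filter (fun m => τ m = j)) x‖ ^ 4 ∂muI := by
        refine integral_mono (integ_of_cont ((tp_continuous _ _).norm.pow 4))
          (integ_of_cont (continuous_const.mul (continuous_finsetSum _ fun j _ => hc j))) ?_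
        intro x
        show ‖tp c Γ x‖ ^ 4 ≤ _
        rw [e1 x]
        have h1 : ‖∑ j, tp c (Γ.filter (fun m => τ m = j)) x‖ ^ 4
            ≤ (∑ j, ‖tp c (Γ.filter (fun m => τ m = j)) x‖) ^ 4 := by
          gcongr; exact norm_sum_le _ _
        refine h1.trans ?_
        have h3 := pow_sum_le_card_mul_sum_pow (s := (Finset.univ : Finset ι))
          (f := fun j => ‖tp c (Γ.filter (fun m => τ m = j)) x‖) (fun j _ => norm_nonneg _) 3
        simpa [Finset.card_univ] using h3
    _ = (Fintype.card ι : ℝ) ^ 3 * ∑ j, ∫ x, ‖tp c (Γ.filter (fun m => τ m = j)) x‖ ^ 4 ∂muI := by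
        rw [integral_const_mul, integral_finsetSum _ fun j _ => integ_of_cont (hc j)]
    _ ≤ (Fintype.card ι : ℝ) ^ 3 * ∑ j : ι, (K * ∑ m ∈ Γ, ‖c m‖ ^ 2) ^ 2 := by
        gcongr with j
        refine (h j).trans ?_
        gcongr
        exact Finset.filter_subset _ _
    _ = _ := by simp; ring

lemma lac_growth {lam : ℝ} (hlam : 1 < lam) {n : ℕ → ℕ} (hn : IsLacunary lam n) (k i : ℕ) :
    lam ^ i * (n k : ℝ) ≤ n (k + i) := by
  induction i with
  | zero => simp
  | succ i ih =>
    have h := (hn.2 (k + i)).le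
    calc lam ^ (i + 1) * (n k : ℝ) = lam * (lam ^ i * n k) := by ring
      _ ≤ lam * n (k + i) := by gcongr
      _ ≤ _ := h

lemma lac_mono {lam : ℝ} (hlam : 1 < lam) {n : ℕ → ℕ} (hn : IsLacunary lam n) : Monotone n := by
  refine monotone_nat_of_le_succ fun k => ?_
  have h := lac_growth hlam hn k 1
  have h2 : (n k : ℝ) ≤ lam ^ 1 * n k := by
    have : (0:ℝ) ≤ n k := Nat.cast_nonneg _
    nlinarith
  exact_mod_cast h2.trans h

/-- The sign attached to a Boolean. -/
def sgnB (b : Bool) : ℤ := if b then 1 else -1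

lemma peel {lam : ℝ} (hlam : 1 < lam) {n : ℕ → ℕ} (hn : IsLacunary lam n) (l : ℕ)
    (hθ : ∑ j ∈ Finset.range l, lam⁻¹ ^ (j + 1) < 1) (m : ℤ) (hm : m ∈ SignedSums n (l + 1)) :
    ∃ k b, m - sgnB b * n k ∈ SignedSums n l ∧
      (1 - ∑ j ∈ Finset.range l, lam⁻¹ ^ (j + 1)) * n k ≤ |(m : ℝ)| ∧ |(m : ℝ)| ≤ 2 * n k := by
  obtain ⟨k, ε, hk, hε, rfl⟩ := hm
  obtain ⟨b, hb⟩ : ∃ b, ε 0 = sgnB b := by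
    rcases hε 0 with h | h
    · exact ⟨true, by simp [sgnB, h]⟩
    · exact ⟨false, by simp [sgnB, h]⟩
  have e0 : ∑ j, ε j * (n (k j) : ℤ) - sgnB b * n (k 0) =
      ∑ j : Fin l, ε j.succ * (n (k j.succ) : ℤ) := by
    rw [Fin.sum_univ_succ, hb]; ring
  refine ⟨k 0, b, ?_, ?_⟩
  · rw [e0]
    refine ⟨fun j => k j.succ, fun j => ε j.succ, ?_, fun j => hε _, rfl⟩
    intro i j hij
    exact hk (Fin.succ_lt_succ_iff.2 hij)
  have hgap : ∀ i : ℕ, ∀ hi : i < l + 1, k ⟨i, hi⟩ + i ≤ k 0 := by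
    intro i
    induction i with
    | zero => intro hi; exact le_refl _
    | succ i ih =>
      intro hi
      have h1 := ih (by omega)
      have h2 : k ⟨i + 1, hi⟩ < k ⟨i, by omega⟩ := hk (by simp [Fin.lt_def])
      omega
  have hlam0 : 0 < lam := by linarith
  have hterm : ∀ j : Fin l, |((ε j.succ : ℤ) : ℝ) * (n (k j.succ) : ℝ)|
      ≤ lam⁻¹ ^ ((j : ℕ) + 1) * n (k 0) := by
    intro j
    have h1 : |((ε j.succ : ℤ) : ℝ)| = 1 := by
      rcases hε j.succ with h | h <;> simp [h]
    rw [abs_mul, h1, one_mul, Nat.abs_cast, inv_pow, ← div_eq_inv_mul, le_div_iff₀ (by positivity),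
      mul_comm]
    refine (lac_growth hlam hn _ _).trans ?_
    have := hgap ((j : ℕ) + 1) (by omega)
    exact_mod_cast lac_mono hlam hn this
  have hrest : |((∑ j : Fin l, ε j.succ * (n (k j.succ) : ℤ) : ℤ) : ℝ)| ≤
      (∑ j ∈ Finset.range l, lam⁻¹ ^ (j + 1)) * n (k 0) := by
    push_cast
    refine (Finset.abs_sum_le_sum_abs _ _).trans ?_
    rw [Finset.sum_range, Finset.sum_mul]
    exact Finset.sum_le_sum fun j _ => hterm j
  have e1 : ((∑ j, ε j * (n (k j) : ℤ) : ℤ) : ℝ) = (sgnB b : ℝ) * n (k 0) +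
      ((∑ j : Fin l, ε j.succ * (n (k j.succ) : ℤ) : ℤ) : ℝ) := by
    rw [← e0]; push_cast; ring
  have habs : |(sgnB b : ℝ) * n (k 0)| = n (k 0) := by
    rw [abs_mul]; cases b <;> simp [sgnB]
  have hpos : (0:ℝ) ≤ n (k 0) := Nat.cast_nonneg _
  rw [e1]
  generalize ((∑ j : Fin l, ε j.succ * (n (k j.succ) : ℤ) : ℤ) : ℝ) = R at *
  constructor
  · have := abs_sub_abs_le_abs_sub ((sgnB b : ℝ) * n (k 0)) (-R)
    rw [abs_neg, sub_neg_eq_add, habs] at this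
    linarith
  · refine (abs_add_le _ _).trans ?_
    rw [habs]
    nlinarith

lemma shift (c : ℤ → ℂ) (Γ : Finset ℤ) (s : ℤ) (x : ℝ) :
    ‖tp c Γ x‖ = ‖tp (fun m => c (m + s)) (Γ.image (fun m => m - s)) x‖ := by
  have : tp c Γ x = expi s x * tp (fun m => c (m + s)) (Γ.image (fun m => m - s)) x := by
    unfold tp
    rw [Finset.sum_image (by intro a _ b _ h; simpa using h), Finset.mul_sum]
    refine Finset.sum_congr rfl fun m _ => ?_
    have : expi m x = expi s x * expi (m - s) x := by rw [← expi_add]; congr 1; ring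
    rw [this]; simp; ring
  rw [this, norm_mul, expi_norm, one_mul]

lemma lambda4 {lam : ℝ} (hlam : 1 < lam) {n : ℕ → ℕ} (hn : IsLacunary lam n) (l : ℕ) :
    (∑ j ∈ Finset.range (l - 1), lam⁻¹ ^ (j + 1) < 1) →
    ∃ K : ℝ, 0 ≤ K ∧ ∀ (c : ℤ → ℂ) (Γ : Finset ℤ), ↑Γ ⊆ SignedSums n l →
      ∫ x, ‖tp c Γ x‖ ^ 4 ∂muI ≤ (K * ∑ m ∈ Γ, ‖c m‖ ^ 2) ^ 2 := by
  have hlam0 : 0 < lam := by linarith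
  induction l with
  | zero =>
    intro _
    refine ⟨1, zero_le_one, fun c Γ hΓ => ?_⟩
    have hz : ∀ m ∈ Γ, m = 0 := by
      intro m hm
      obtain ⟨k, ε, _, _, h⟩ := hΓ hm
      simpa using h
    have hcase : Γ = ∅ ∨ Γ = {0} := by
      rw [← Finset.subset_singleton_iff]
      intro m hm; simpa using hz m hm
    rcases hcase with rfl | rfl
    · simp [tp]
    · simp [tp, expi_norm]
      rw [← pow_mul]
  | succ l ih =>
    intro hθ
    rw [Nat.add_sub_cancel] at hθ
    obtain ⟨K, hK, hKi⟩ := ih (by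
      refine lt_of_le_of_lt ?_ hθ
      refine Finset.sum_le_sum_of_subset_of_nonneg ?_ fun i _ _ => by positivity
      intro i; simp only [Finset.mem_range]; omega)
    set θ := ∑ j ∈ Finset.range l, lam⁻¹ ^ (j + 1) with hθdef
    have hex : ∀ m : ℤ, ∃ k b, m ∈ SignedSums n (l + 1) → m - sgnB b * n k ∈ SignedSums n l ∧
        (1 - θ) * n k ≤ |(m : ℝ)| ∧ |(m : ℝ)| ≤ 2 * n k := by
      intro m
      by_cases hm : m ∈ SignedSums n (l + 1)
      · obtain ⟨k, b, h⟩ := peel hlam hn l hθ m hm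
        exact ⟨k, b, fun _ => h⟩
      · exact ⟨0, true, fun h => absurd h hm⟩
    choose κ σ hκ using hex
    obtain ⟨q, hq⟩ : ∃ q : ℕ, 6 / (1 - θ) < lam ^ q := pow_unbounded_of_one_lt _ hlam
    have h1θ : 0 < 1 - θ := by linarith
    rw [div_lt_iff₀ h1θ] at hq
    let τ : ℤ → Fin (q + 1) × Bool := fun m => (⟨κ m % (q + 1), Nat.mod_lt _ (by omega)⟩, σ m)
    refine ⟨(Fintype.card (Fin (q + 1) × Bool) : ℝ) ^ 2 * (4 * K), by positivity,
      fun c Γ hΓ => ?_⟩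
    refine classes c Γ τ (4 * K) (by positivity) fun j => ?_
    refine blocks c _ κ K hK ?_ ?_
    · intro a ha b hb hab
      rw [Finset.mem_filter] at ha hb
      have hmod : κ a % (q + 1) = κ b % (q + 1) := by
        have := congrArg (fun z => (z.1 : ℕ)) (ha.2.trans hb.2.symm)
        simpa [τ] using this
      have hge : κ a + q ≤ κ b := by
        have h1 : (q + 1) ∣ κ b - κ a := (Nat.modEq_iff_dvd' hab.le).1 hmod
        have := Nat.le_of_dvd (by omega) h1
        omega
      have ha' := (hκ a (hΓ ha.1)).2.2
      have hb' := (hκ b (hΓ hb.1)).2.1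
      have hg := lac_growth hlam hn (κ a) q
      have hm : (n (κ a + q) : ℝ) ≤ n (κ b) := by exact_mod_cast lac_mono hlam hn hge
      have hp : (0:ℝ) < n (κ a) := by exact_mod_cast hn.1 _
      have : 3 * |(a:ℝ)| < |(b:ℝ)| := by
        calc 3 * |(a:ℝ)| ≤ 6 * n (κ a) := by linarith
          _ < lam ^ q * (1 - θ) * n (κ a) := by gcongr
          _ = (1 - θ) * (lam ^ q * n (κ a)) := by ring
          _ ≤ (1 - θ) * n (κ b) := by gcongr; linarith
          _ ≤ _ := hb'
      exact_mod_cast this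
    · intro k
      set Γ' := (Γ.filter (fun m => τ m = j)).filter (fun m => κ m = k) with hΓ'
      have hmem : ∀ m ∈ Γ', m - sgnB j.2 * n k ∈ SignedSums n l := by
        intro m hm
        rw [hΓ', Finset.mem_filter, Finset.mem_filter] at hm
        have h1 := (hκ m (hΓ hm.1.1)).1
        have h2 : σ m = j.2 := congrArg Prod.snd hm.1.2
        rwa [h2, hm.2] at h1
      simp_rw [shift c Γ' (sgnB j.2 * n k)]
      refine (hKi _ _ ?_).trans (le_of_eq ?_)
      · intro m hm
        simp only [Finset.coe_image, Set.mem_image] at hm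
        obtain ⟨m', hm', rfl⟩ := hm
        exact hmem m' hm'
      · rw [Finset.sum_image (by intro a _ b _ h; simpa using h)]
        simp

lemma four_ineq (u v : ℝ) : (u + v) ^ 4 ≤ 729 * u ^ 4 + 3 / 2 * v ^ 4 := by
  have h1 : (u + v) ^ 2 ≤ 9 * u ^ 2 + 9 / 8 * v ^ 2 := by nlinarith [sq_nonneg (8 * u - v)]
  have h2 : (u + v) ^ 4 = ((u + v) ^ 2) ^ 2 := by ring
  rw [h2]
  have h3 : ((u + v) ^ 2) ^ 2 ≤ (9 * u ^ 2 + 9 / 8 * v ^ 2) ^ 2 := by gcongr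
  nlinarith [sq_nonneg (8 * u ^ 2 - v ^ 2), sq_nonneg (v ^ 2), sq_nonneg (u ^ 2)]

lemma maximal (S : ℕ → ℝ → ℂ) (hS : ∀ i, Continuous (S i)) (g : ℕ → ℝ) (hg : Monotone g)
    (h : ∀ a b, a ≤ b → ∫ x, ‖S b x - S a x‖ ^ 4 ∂muI ≤ (g b - g a) ^ 2) (d : ℕ) :
    ∀ a, ∃ M : ℝ → ℝ, Continuous M ∧ (∀ x, 0 ≤ M x) ∧
      (∀ i, a ≤ i → i ≤ a + d → ∀ x, ‖S i x - S a x‖ ≤ M x) ∧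
      ∫ x, M x ^ 4 ∂muI ≤ 2916 * (g (a + d) - g a) ^ 2 := by
  induction d using Nat.strong_induction_on with
  | _ d ih =>
  intro a
  rcases Nat.eq_zero_or_pos d with rfl | hd
  · refine ⟨fun _ => 0, continuous_const, fun _ => le_refl _, ?_, by simp⟩
    intro i h1 h2 x
    have : i = a := by omega
    simp [this]
  have hex : ∃ j, 1 ≤ j ∧ (j = d ∨ (g a + g (a + d)) / 2 ≤ g (a + j)) := ⟨d, hd, Or.inl rfl⟩
  classical
  obtain ⟨j, hj1, hjd, hjl, hjr⟩ : ∃ j, 1 ≤ j ∧ j ≤ d ∧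
      g (a + (j - 1)) - g a ≤ (g (a + d) - g a) / 2 ∧
      g (a + d) - g (a + j) ≤ (g (a + d) - g a) / 2 := by
    have hmono : g a ≤ g (a + d) := hg (by omega)
    refine ⟨Nat.find hex, (Nat.find_spec hex).1, Nat.find_min' hex ⟨hd, Or.inl rfl⟩, ?_, ?_⟩
    · by_cases h0 : Nat.find hex - 1 = 0
      · rw [h0]; simp; linarith
      · have := Nat.find_min hex (m := Nat.find hex - 1) (by omega)
        push Not at this
        have := (this (by omega)).2
        linarith
    · rcases (Nat.find_spec hex).2 with h1 | h1
      · rw [h1]; linarith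
      · linarith
  obtain ⟨M1, c1, p1, b1, i1⟩ := ih (j - 1) (by omega) a
  obtain ⟨M2, c2, p2, b2, i2⟩ := ih (d - j) (by omega) (a + j)
  have e : a + j + (d - j) = a + d := by omega
  rw [e] at b2 i2
  have cu : Continuous fun x => ‖S (a + j) x - S a x‖ := ((hS _).sub (hS _)).norm
  refine ⟨fun x => ‖S (a + j) x - S a x‖ + max (M1 x) (M2 x), by fun_prop, ?_, ?_, ?_⟩
  · intro x
    have := p1 x
    positivity
  · intro i h1 h2 x
    show _ ≤ ‖S (a + j) x - S a x‖ + max (M1 x) (M2 x)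
    by_cases hi : i ≤ a + (j - 1)
    · have := b1 i h1 hi x
      have := le_max_left (M1 x) (M2 x)
      have := norm_nonneg (S (a + j) x - S a x)
      linarith
    · have h3 := b2 i (by omega) h2 x
      have h4 := le_max_right (M1 x) (M2 x)
      have h5 := norm_add_le (S i x - S (a + j) x) (S (a + j) x - S a x)
      rw [sub_add_sub_cancel] at h5
      linarith
  · calc ∫ x, (‖S (a + j) x - S a x‖ + max (M1 x) (M2 x)) ^ 4 ∂muI
        ≤ ∫ x, (729 * ‖S (a + j) x - S a x‖ ^ 4 + 3 / 2 * (M1 x ^ 4 + M2 x ^ 4)) ∂muI := by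
          refine integral_mono (integ_of_cont (by fun_prop)) (integ_of_cont (by fun_prop)) ?_
          intro x
          refine (four_ineq _ _).trans ?_
          show _ ≤ 729 * ‖S (a + j) x - S a x‖ ^ 4 + 3 / 2 * (M1 x ^ 4 + M2 x ^ 4)
          have q1 : 0 ≤ M1 x ^ 4 := by positivity
          have q2 : 0 ≤ M2 x ^ 4 := by positivity
          rcases max_choice (M1 x) (M2 x) with h3 | h3 <;> rw [h3] <;> linarith
      _ = 729 * ∫ x, ‖S (a + j) x - S a x‖ ^ 4 ∂muI +
          3 / 2 * (∫ x, M1 x ^ 4 ∂muI + ∫ x, M2 x ^ 4 ∂muI) := by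
          rw [integral_add (integ_of_cont (by fun_prop)) (integ_of_cont (by fun_prop)),
            integral_const_mul, integral_const_mul,
            integral_add (integ_of_cont (by fun_prop)) (integ_of_cont (by fun_prop))]
      _ ≤ 729 * (g (a + d) - g a) ^ 2 + 3 / 2 * (2916 * ((g (a + d) - g a) / 2) ^ 2 +
          2916 * ((g (a + d) - g a) / 2) ^ 2) := by
          have q0 := h a (a + j) (by omega)
          have m1 : g a ≤ g (a + (j - 1)) := hg (by omega)
          have m2 : g (a + j) ≤ g (a + d) := hg (by omega)
          have m3 : g a ≤ g (a + j) := hg (by omega)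
          have r0 : (g (a + j) - g a) ^ 2 ≤ (g (a + d) - g a) ^ 2 := by
            gcongr
          have r1 : (g (a + (j - 1)) - g a) ^ 2 ≤ ((g (a + d) - g a) / 2) ^ 2 := by
            gcongr
          have r2 : (g (a + d) - g (a + j)) ^ 2 ≤ ((g (a + d) - g a) / 2) ^ 2 := by
            gcongr
          linarith
      _ = _ := by ring

lemma ae_conv (S : ℕ → ℝ → ℂ) (hS : ∀ i, Continuous (S i)) (g : ℕ → ℝ) (hg : Monotone g)
    (hb : BddAbove (Set.range g))
    (h : ∀ a b, a ≤ b → ∫ x, ‖S b x - S a x‖ ^ 4 ∂muI ≤ (g b - g a) ^ 2) :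
    ∀ᵐ x ∂muI, ∃ L : ℂ, Tendsto (fun i => S i x) atTop (𝓝 L) := by
  set G := ⨆ i, g i with hG
  have hlim : Tendsto g atTop (𝓝 G) := tendsto_atTop_ciSup hg hb
  have hle : ∀ i, g i ≤ G := fun i => le_ciSup hb i
  -- tail estimate
  have tail : ∀ ε : ℝ, 0 < ε → ∀ a, muI {x | ∃ i, a ≤ i ∧ ε ≤ ‖S i x - S a x‖} ≤
      ENNReal.ofReal (2916 * (G - g a) ^ 2 / ε ^ 4) := by
    intro ε hε a
    have hU : {x | ∃ i, a ≤ i ∧ ε ≤ ‖S i x - S a x‖} =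
        ⋃ d : ℕ, {x | ∃ i, a ≤ i ∧ i ≤ a + d ∧ ε ≤ ‖S i x - S a x‖} := by
      ext x
      simp only [Set.mem_ofPred_eq, Set.mem_iUnion]
      constructor
      · rintro ⟨i, h1, h2⟩; exact ⟨i, i, h1, by omega, h2⟩
      · rintro ⟨d, i, h1, _, h2⟩; exact ⟨i, h1, h2⟩
    have hmon : Monotone fun d : ℕ => {x | ∃ i, a ≤ i ∧ i ≤ a + d ∧ ε ≤ ‖S i x - S a x‖} := by
      rintro d e hde x ⟨i, h1, h2, h3⟩
      exact ⟨i, h1, by omega, h3⟩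
    rw [hU, hmon.measure_iUnion]
    refine iSup_le fun d => ?_
    obtain ⟨M, cM, pM, bM, iM⟩ := maximal S hS g hg h d a
    have hsub : {x | ∃ i, a ≤ i ∧ i ≤ a + d ∧ ε ≤ ‖S i x - S a x‖} ⊆ {x | ε ^ 4 ≤ M x ^ 4} := by
      rintro x ⟨i, h1, h2, h3⟩
      have := h3.trans (bM i h1 h2 x)
      show ε ^ 4 ≤ M x ^ 4
      gcongr
    refine (measure_mono hsub).trans ?_
    have hmk := mul_meas_ge_le_integral_of_nonneg (μ := muI) (f := fun x => M x ^ 4)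
      (ae_of_all _ fun x => pow_nonneg (pM x) 4) (integ_of_cont (by fun_prop)) (ε ^ 4)
    rw [ENNReal.le_ofReal_iff_toReal_le (measure_ne_top _ _) (by positivity),
      le_div_iff₀ (by positivity), mul_comm]
    refine hmk.trans (iM.trans ?_)
    have m1 : g a ≤ g (a + d) := hg (by omega)
    have := hle (a + d)
    gcongr
  have hnull : ∀ ε : ℝ, 0 < ε → ∀ᵐ x ∂muI, ∃ a, ∀ i, a ≤ i → ‖S i x - S a x‖ < ε := by
    intro ε hε
    rw [ae_iff]
    have hle2 : ∀ a, muI {x | ¬ ∃ a, ∀ i, a ≤ i → ‖S i x - S a x‖ < ε} ≤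
        ENNReal.ofReal (2916 * (G - g a) ^ 2 / ε ^ 4) := by
      intro a
      refine (measure_mono ?_).trans (tail ε hε a)
      intro x hx
      simp only [Set.mem_ofPred_eq, not_exists, not_forall, not_lt] at hx
      obtain ⟨i, h1, h2⟩ := hx a
      exact ⟨i, h1, h2⟩
    have ht : Tendsto (fun a => ENNReal.ofReal (2916 * (G - g a) ^ 2 / ε ^ 4)) atTop (𝓝 0) := by
      rw [← ENNReal.ofReal_zero]
      refine ENNReal.tendsto_ofReal ?_
      have := (((tendsto_const_nhds (x := G)).sub hlim).pow 2).const_mul 2916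
      have := this.div_const (ε ^ 4)
      simpa using this
    exact le_antisymm (ge_of_tendsto' ht hle2) zero_le
  have hall : ∀ᵐ x ∂muI, ∀ k : ℕ, ∃ a, ∀ i, a ≤ i → ‖S i x - S a x‖ < 1 / ((k:ℝ) + 1) :=
    ae_all_iff.2 fun k => hnull _ (by positivity)
  filter_upwards [hall] with x hx
  refine cauchySeq_tendsto_of_complete (Metric.cauchySeq_iff'.2 fun ε hε => ?_)
  obtain ⟨k, hk⟩ := exists_nat_one_div_lt hε
  obtain ⟨a, ha⟩ := hx k
  exact ⟨a, fun i hi => by rw [dist_eq_norm]; exact (ha i hi).trans hk⟩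

lemma theta_lt {l : ℕ} (hl : 2 ≤ l) {laml lam : ℝ} (hlaml : 1 < laml)
    (hlameq : laml ^ (l - 1) = ∑ i ∈ Finset.range (l - 1), laml ^ i) (hlam : laml < lam) :
    ∑ j ∈ Finset.range (l - 1), lam⁻¹ ^ (j + 1) < 1 := by
  have h0 : 0 < laml := by linarith
  have h1 : ∑ j ∈ Finset.range (l - 1), laml⁻¹ ^ (j + 1) = 1 := by
    have hp : laml ^ (l - 1) ≠ 0 := by positivity
    apply mul_right_cancel₀ hp
    rw [one_mul]
    conv_rhs => rw [hlameq]
    rw [← Finset.sum_range_reflect, Finset.sum_mul]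
    refine Finset.sum_congr rfl fun j hj => ?_
    rw [Finset.mem_range] at hj
    have e : laml ^ (l - 1) = laml ^ (l - 1 - 1 - j + 1) * laml ^ j := by
      rw [← pow_add]; congr 1; omega
    rw [e, inv_pow, inv_mul_cancel_left₀ (by positivity)]
  rw [← h1]
  refine Finset.sum_lt_sum_of_nonempty (by simp; omega) fun j _ => ?_
  have : lam⁻¹ < laml⁻¹ := inv_strictAnti₀ h0 hlam
  have h2 : 0 ≤ lam⁻¹ := by have : 0 < lam := by linarith
                            positivity
  exact pow_lt_pow_left₀ this h2 (by omega)

/-- **Corollary 1 (direct part).** If `l ≥ 2`, `λ > λ_l` and `N` is a `λ`-lacunary sequence,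
then `{e^{2πimx} : m ∈ N(l)}` is an unconditional convergence system: whenever
`∑_{m ∈ N(l)} |c_m|² < ∞`, for every increasing sequence of finite sets `Γ_n ⊆ N(l)` the sums
`∑_{m ∈ Γ_n} c_m e^{2πimx}` converge a.e. on `(0,1)` as `n → ∞`. -/
theorem statement1 (l : ℕ) (hl : 2 ≤ l)
    (laml : ℝ) (hlaml : 1 < laml)
    (hlameq : laml ^ (l - 1) = ∑ i ∈ Finset.range (l - 1), laml ^ i)
    (lam : ℝ) (hlam : laml < lam)
    (n : ℕ → ℕ) (hn : IsLacunary lam n)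
    (c : ℤ → ℂ) (hc : Summable (fun m : SignedSums n l => ‖c (m : ℤ)‖ ^ 2))
    (Γ : ℕ → Finset ℤ) (hΓmono : Monotone Γ) (hΓ : ∀ i, ↑(Γ i) ⊆ SignedSums n l) :
    ∀ᵐ x ∂(volume.restrict (Set.Ioo (0:ℝ) 1)),
      ∃ L : ℂ, Tendsto (fun i => ∑ m ∈ Γ i, c m * expi m x) atTop (𝓝 L) := by
  obtain ⟨K, hK, hΛ⟩ := lambda4 (hlaml.trans hlam) hn l (theta_lt hl hlaml hlameq hlam)
  refine ae_conv (fun i => tp c (Γ i)) (fun i => tp_continuous _ _)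
    (fun i => K * ∑ m ∈ Γ i, ‖c m‖ ^ 2) ?_ ?_ ?_
  · intro a b hab
    have := hΓmono hab
    show K * ∑ m ∈ Γ a, ‖c m‖ ^ 2 ≤ K * ∑ m ∈ Γ b, ‖c m‖ ^ 2
    gcongr
  · refine ⟨K * ∑' m : SignedSums n l, ‖c (m : ℤ)‖ ^ 2, ?_⟩
    rintro _ ⟨i, rfl⟩
    show K * ∑ m ∈ Γ i, ‖c m‖ ^ 2 ≤ _
    gcongr
    classical
    have h1 := hc.sum_le_tsum ((Γ i).subtype (fun m => m ∈ SignedSums n l))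
      (fun _ _ => by positivity)
    rwa [Finset.sum_subtype_of_mem (fun m => ‖c m‖ ^ 2) (fun m hm => hΓ i hm)] at h1
  · intro a b hab
    have hsub := hΓmono hab
    have e1 : ∀ x, tp c (Γ b) x - tp c (Γ a) x = tp c (Γ b \ Γ a) x := by
      intro x; unfold tp
      rw [← Finset.sum_sdiff hsub]; ring
    have e2 : K * ∑ m ∈ Γ b, ‖c m‖ ^ 2 - K * ∑ m ∈ Γ a, ‖c m‖ ^ 2 =
        K * ∑ m ∈ Γ b \ Γ a, ‖c m‖ ^ 2 := by
      rw [← Finset.sum_sdiff hsub]; ring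
    simp_rw [e1, e2]
    refine hΛ c _ ?_
    intro m hm
    exact hΓ b (Finset.sdiff_subset hm)
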